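/- Let G be a graph, A ⊆ V(G), r, m ∈ ℕ, and suppose wcol_r(G) = c. If |A| ≥ 4·(2cm)^c, then there exist sets S ⊆ V(G) and B ⊆ A \ S such that |S| ≤ c, |B| ≥ m, and B is distance-r independent in G − S. -/

import Mathlib

open SimpleGraph

variable {V : Type} {W : Type}

/-- The set of vertices at distance at most `r` from `v` in `G`. -/
def ball (G : SimpleGraph V) (r : ℕ) (v : V) : Set V :=
  {u | ∃ p : G.Walk v u, p.length ≤ r}

/-- `G` has radius at most `r`. -/
def hasRadiusLE (G : SimpleGraph V) (r : ℕ) : Prop :=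
  ∃ u : V, ∀ v : V, ∃ p : G.Walk u v, p.length ≤ r

/-- `H` is a depth-`r` minor of `G`: there are pairwise disjoint branch sets of
radius at most `r`, one for each vertex of `H`, connected appropriately. -/
def IsDepthMinor (r : ℕ) (H : SimpleGraph W) (G : SimpleGraph V) : Prop :=
  ∃ φ : W → Set V,
    (∀ w : W, hasRadiusLE (G.induce (φ w)) r) ∧
    (Pairwise fun w w' => Disjoint (φ w) (φ w')) ∧
    (∀ a b : W, H.Adj a b → ∃ u ∈ φ a, ∃ v ∈ φ b, G.Adj u v)

/-- `H` is a minor of `G` (no restriction on the radius of branch sets). -/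
def IsMinorOf (H : SimpleGraph W) (G : SimpleGraph V) : Prop :=
  ∃ φ : W → Set V,
    (∀ w : W, (G.induce (φ w)).Connected) ∧
    (Pairwise fun w w' => Disjoint (φ w) (φ w')) ∧
    (∀ a b : W, H.Adj a b → ∃ u ∈ φ a, ∃ v ∈ φ b, G.Adj u v)

/-- A bundled finite graph. -/
structure FGraph : Type 1 where
  V : Type
  [fintypeV : Fintype V]
  G : SimpleGraph V

attribute [instance] FGraph.fintypeV

/-- A class of graphs is nowhere dense if for every `r` there is `m` such that
`K_m` is not a depth-`r` minor of any member. -/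
def NowhereDense (C : Set FGraph) : Prop :=
  ∀ r : ℕ, ∃ m : ℕ, ∀ G ∈ C, ¬ IsDepthMinor r (⊤ : SimpleGraph (Fin m)) G.G

/-- A class of graphs has bounded expansion if for every `r` the edge density of
depth-`r` minors of members is bounded. -/
def BoundedExpansion (C : Set FGraph) : Prop :=
  ∀ r : ℕ, ∃ d : ℝ, ∀ G ∈ C, ∀ (n : ℕ) (H : SimpleGraph (Fin n)),
    IsDepthMinor r H G.G → (H.edgeSet.ncard : ℝ) / (n : ℝ) ≤ d

/-- `H` is (isomorphic to) a subgraph of `G`. -/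
def IsSubgraphOf (H G : FGraph) : Prop :=
  ∃ f : H.V → G.V, Function.Injective f ∧ ∀ a b : H.V, H.G.Adj a b → G.G.Adj (f a) (f b)

/-- `N_r^{G-S}(v)`, the ball of radius `r` around `v` in `G - S`, as a subset of `V`. -/
def ballAvoiding (G : SimpleGraph V) (S : Set V) (r : ℕ) (v : V) : Set V :=
  {u | ∃ p : G.Walk v u, p.length ≤ r ∧ ∀ x ∈ p.support, x ∉ S}

/-- `B` is distance-`r` independent in `G - S`: distinct vertices of `B` have
distance greater than `r` in `G - S`. -/
def DistIndepIn (G : SimpleGraph V) (S : Set V) (r : ℕ) (B : Set V) : Prop :=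
  ∀ u ∈ B, ∀ v ∈ B, u ≠ v →
    ∀ p : G.Walk u v, (∀ x ∈ p.support, x ∉ S) → r < p.length

/-- Uniform quasi-wideness. -/
def UniformlyQuasiWide (C : Set FGraph) : Prop :=
  ∀ r : ℕ, ∃ s : ℕ, ∀ m : ℕ, ∃ N : ℕ, ∀ G ∈ C, ∀ A : Set G.V,
    N ≤ A.ncard → ∃ S : Set G.V, S.ncard ≤ s ∧
      ∃ B ⊆ A \ S, m ≤ B.ncard ∧ DistIndepIn G.G S r B

/-- Splitter wins the simple `ℓ`-round radius-`r` splitter game on `G`. -/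
def SplitterWins (r : ℕ) : (ℓ : ℕ) → (V : Type) → SimpleGraph V → Prop
  | 0, V, _ => IsEmpty V
  | (ℓ + 1), _, G =>
      ∀ C : G.Subgraph, hasRadiusLE C.coe r →
        ∃ w ∈ C.verts, SplitterWins r ℓ _ ((C.deleteVerts {w}).coe)

/-- Splitter wins the `ℓ`-round treedepth game on `G`. -/
def TDSplitterWins : (ℓ : ℕ) → (V : Type) → SimpleGraph V → Prop
  | 0, V, _ => IsEmpty V
  | (ℓ + 1), _, G =>
      ∀ c : G.ConnectedComponent, ∃ w ∈ c.supp,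
        TDSplitterWins ℓ _ (G.induce (c.supp \ {w}))

/-- Splitter wins the variant of the `ℓ`-round radius-`r` splitter game in which
she may delete up to `m` vertices per round. -/
def SplitterWinsSets (r m : ℕ) : (ℓ : ℕ) → (V : Type) → SimpleGraph V → Prop
  | 0, V, _ => IsEmpty V
  | (ℓ + 1), _, G =>
      ∀ C : G.Subgraph, hasRadiusLE C.coe r →
        ∃ W ⊆ C.verts, W.ncard ≤ m ∧ SplitterWinsSets r m ℓ _ ((C.deleteVerts W).coe)

/-- `le` is the ancestor order of a rooted forest: a partial order in which the
set of ancestors of any element is a chain. -/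
def IsForestOrder (le : V → V → Prop) : Prop :=
  (∀ v, le v v) ∧ (∀ u v w, le u v → le v w → le u w) ∧
  (∀ u v, le u v → le v u → u = v) ∧
  (∀ v u w, le u v → le w v → le u w ∨ le w u)

/-- `G` has treedepth at most `ℓ`: there is a rooted forest of depth at most `ℓ`
on `V(G)` such that every edge joins an ancestor-descendant pair. -/
def TreedepthLE (G : SimpleGraph V) (ℓ : ℕ) : Prop :=
  ∃ le : V → V → Prop, IsForestOrder le ∧
    (∀ u v, G.Adj u v → le u v ∨ le v u) ∧
    ∀ v, ({u | le u v}).ncard ≤ ℓ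

/-- The treedepth of `G`. -/
noncomputable def treedepth (G : SimpleGraph V) : ℕ := sInf {ℓ | TreedepthLE G ℓ}

/-- `WReach G le r v`: the set of vertices weakly `r`-reachable from `v`
with respect to the linear order `le`. -/
def WReach (G : SimpleGraph V) (le : V → V → Prop) (r : ℕ) (v : V) : Set V :=
  {u | le u v ∧ ∃ p : G.Walk u v, p.IsPath ∧ p.length ≤ r ∧
    ∀ x ∈ p.support, x ≠ u → x ≠ v → le u x ∧ u ≠ x}

/-- `WReachInf G le v`: the set of vertices weakly reachable from `v`
with respect to the linear order `le` (no bound on path length). -/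
def WReachInf (G : SimpleGraph V) (le : V → V → Prop) (v : V) : Set V :=
  {u | le u v ∧ ∃ p : G.Walk u v, p.IsPath ∧
    ∀ x ∈ p.support, x ≠ u → x ≠ v → le u x ∧ u ≠ x}

/-- The weak `r`-coloring number of `G`. -/
noncomputable def wcol (G : SimpleGraph V) (r : ℕ) : ℕ :=
  sInf {k | ∃ le : V → V → Prop, IsLinearOrder V le ∧ ∀ v, (WReach G le r v).ncard ≤ k}

/-- The coloring number of `G`: the least `k` such that some linear order has
every vertex with at most `k - 1` smaller neighbors. -/
noncomputable def coloringNumber (G : SimpleGraph V) : ℕ :=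
  sInf {k | ∃ le : V → V → Prop, IsLinearOrder V le ∧
    ∀ v, ({u | G.Adj u v ∧ le u v ∧ u ≠ v}).ncard + 1 ≤ k}

/-- `X` is an `r`-neighborhood cover of `G` with clusters of radius at most `ρ`:
each cluster induces a connected subgraph of radius at most `ρ`, and every
`r`-ball is contained in some cluster. -/
def IsNbhdCover (G : SimpleGraph V) (r ρ : ℕ) (X : Set (Set V)) : Prop :=
  (∀ C ∈ X, hasRadiusLE (G.induce C) ρ) ∧ ∀ v : V, ∃ C ∈ X, ball G r v ⊆ C

/-- The cluster `X_r[G,π,u] = {w : u ∈ WReach_r[G,π,w]}`. -/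
def XCluster (G : SimpleGraph V) (le : V → V → Prop) (r : ℕ) (u : V) : Set V :=
  {w | u ∈ WReach G le r w}

/-- The smaller endpoint of an edge. -/
def sym2Min {n : ℕ} (e : Sym2 (Fin n)) : Fin n :=
  Sym2.lift ⟨fun a b => min a b, fun _ _ => min_comm _ _⟩ e

/-- The larger endpoint of an edge. -/
def sym2Max {n : ℕ} (e : Sym2 (Fin n)) : Fin n :=
  Sym2.lift ⟨fun a b => max a b, fun _ _ => max_comm _ _⟩ e

/-- The relation generating the `r`-subdivision of `G`. -/
def SubdivRel {n : ℕ} (r : ℕ) (G : SimpleGraph (Fin n)) :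
    (Fin n ⊕ (G.edgeSet × Fin r)) → (Fin n ⊕ (G.edgeSet × Fin r)) → Prop
  | Sum.inl a, Sum.inl b => r = 0 ∧ G.Adj a b
  | Sum.inl a, Sum.inr ei => ((ei.2 : ℕ) = 0 ∧ a = sym2Min ei.1.1) ∨
      ((ei.2 : ℕ) = r - 1 ∧ a = sym2Max ei.1.1)
  | Sum.inr ei, Sum.inr ej => ei.1 = ej.1 ∧ (ei.2 : ℕ) + 1 = (ej.2 : ℕ)
  | Sum.inr _, Sum.inl _ => False

/-- The `r`-subdivision of `G`: every edge is replaced by a path with `r`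
internal vertices. -/
def Subdivision {n : ℕ} (r : ℕ) (G : SimpleGraph (Fin n)) :
    SimpleGraph ((Fin n) ⊕ (G.edgeSet × Fin r)) :=
  SimpleGraph.fromRel (SubdivRel r G)

/-- A sunflower-type lemma: among many points `a`, each contained in a small set `T a`,
there are `m` whose sets pairwise intersect inside a small set `S` avoiding these points. -/
theorem exists_sunflower {α : Type*} [DecidableEq α] (c m : ℕ) :
    ∀ n ≤ c, ∀ (A : Finset α) (T : α → Finset α), (∀ a ∈ A, a ∈ T a) →
      (∀ a ∈ A, (T a).card ≤ n) → (2 * c * m) ^ n ≤ A.card →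
      ∃ S B : Finset α, S.card ≤ n ∧ B ⊆ A ∧ Disjoint B S ∧ m ≤ B.card ∧
        ∀ u ∈ B, ∀ v ∈ B, u ≠ v → T u ∩ T v ⊆ S := by
  intro n
  induction n with
  | zero =>
    intro _ A T hmem hcard hA
    obtain ⟨a, ha⟩ := Finset.card_pos.mp (by simpa using hA)
    have h := hcard a ha
    have := Finset.card_pos.mpr ⟨a, hmem a ha⟩
    omega
  | succ n ih =>
    intro hn A T hmem hcard hA
    rcases Nat.eq_zero_or_pos m with rfl | hm
    · exact ⟨∅, ∅, by simp⟩
    let F := A.powerset.filter fun B => ∀ u ∈ B, ∀ v ∈ B, u ≠ v → Disjoint (T u) (T v)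
    obtain ⟨B, hBF, hmax⟩ := F.exists_max_image Finset.card ⟨∅, by simp [F]⟩
    obtain ⟨hBA, hB⟩ : B ⊆ A ∧ ∀ u ∈ B, ∀ v ∈ B, u ≠ v → Disjoint (T u) (T v) := by
      simpa [F] using hBF
    by_cases hmB : m ≤ B.card
    · exact ⟨∅, B, by simp, hBA, by simp, hmB, fun u hu v hv huv =>
        (Finset.disjoint_iff_inter_eq_empty.mp (hB u hu v hv huv)).subset⟩
    have hmeet : ∀ a ∈ A, ∃ x ∈ B.biUnion T, x ∈ T a := by
      intro a ha
      by_cases haB : a ∈ B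
      · exact ⟨a, Finset.mem_biUnion.mpr ⟨a, haB, hmem a ha⟩, hmem a ha⟩
      by_contra! hno
      have hdis : ∀ b ∈ B, Disjoint (T b) (T a) := fun b hb =>
        Finset.disjoint_left.mpr fun x hx => hno x (Finset.mem_biUnion.mpr ⟨b, hb, hx⟩)
      have hins : insert a B ∈ F := by
        simp only [F, Finset.mem_filter, Finset.mem_powerset, Finset.mem_insert]
        refine ⟨Finset.insert_subset ha hBA, ?_⟩
        rintro u (rfl | hu) v (rfl | hv) huv
        · exact absurd rfl huv
        · exact (hdis v hv).symm
        · exact hdis u hu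
        · exact hB u hu v hv huv
      have := hmax _ hins
      rw [Finset.card_insert_of_notMem haB] at this
      omega
    have hU : (B.biUnion T).card ≤ m * c :=
      (Finset.card_biUnion_le_card_mul B T c fun b hb => (hcard b (hBA hb)).trans hn).trans
        (Nat.mul_le_mul_right c (by omega))
    have hc : 0 < c := by omega
    have hK : 0 < (2 * c * m) ^ n := by positivity
    obtain ⟨a₀, ha₀⟩ : A.Nonempty :=
      Finset.card_pos.mp (lt_of_lt_of_le (by positivity) hA)
    obtain ⟨x₀, hx₀, -⟩ := hmeet a₀ ha₀
    choose! f hfU hfT using hmeet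
    obtain ⟨x, -, hx⟩ := Finset.exists_le_card_fiber_of_mul_le_card_of_maps_to
      (n := 2 * (2 * c * m) ^ n) hfU ⟨x₀, hx₀⟩
      (calc _ ≤ m * c * (2 * (2 * c * m) ^ n) := Nat.mul_le_mul_right _ hU
        _ = (2 * c * m) ^ (n + 1) := by ring
        _ ≤ A.card := hA)
    have hxT : ∀ a ∈ (A.filter fun a => f a = x).erase x, a ∈ A ∧ a ≠ x ∧ x ∈ T a := by
      intro a ha
      simp only [Finset.mem_erase, Finset.mem_filter] at ha
      exact ⟨ha.2.1, ha.1, ha.2.2 ▸ hfT a ha.2.1⟩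
    obtain ⟨S, B', hS, hB'A, hdis, hmB', hinter⟩ := ih (by omega)
      ((A.filter fun a => f a = x).erase x) (fun a => (T a).erase x)
      (fun a ha => Finset.mem_erase.mpr ⟨(hxT a ha).2.1, hmem a (hxT a ha).1⟩)
      (fun a ha => by
        have h₁ := Finset.card_erase_of_mem (hxT a ha).2.2
        have h₂ := hcard a (hxT a ha).1
        omega)
      (by
        have := Finset.pred_card_le_card_erase (s := A.filter fun a => f a = x) (a := x)
        omega)
    refine ⟨insert x S, B', (Finset.card_insert_le _ _).trans (by omega),
      fun a ha => (hxT a (hB'A ha)).1, ?_, hmB', fun u hu v hv huv y hy => ?_⟩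
    · exact Finset.disjoint_insert_right.mpr ⟨fun h => (hxT x (hB'A h)).2.1 rfl, hdis⟩
    · by_cases hyx : y = x
      · simp [hyx]
      · refine Finset.mem_insert_of_mem (hinter u hu v hv huv ?_)
        simpa [hyx] using hy

/-- The weak coloring number of a finite graph is attained by some linear order. -/
theorem exists_linearOrder_wcol [Finite V] (G : SimpleGraph V) (r : ℕ) :
    ∃ le : V → V → Prop, IsLinearOrder V le ∧ ∀ v, (WReach G le r v).ncard ≤ wcol G r := by
  refine Nat.sInf_mem (s := {k | ∃ le : V → V → Prop, IsLinearOrder V le ∧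
    ∀ v, (WReach G le r v).ncard ≤ k}) ⟨Nat.card V, ?_⟩
  let _ : LinearOrder V := LinearOrder.lift' (Finite.equivFin V) (Finite.equivFin V).injective
  exact ⟨(· ≤ ·), inferInstance, fun v => Set.ncard_le_card _⟩

theorem mem_wreach_self (G : SimpleGraph V) (le : V → V → Prop) [Std.Refl le] (r : ℕ) (v : V) :
    v ∈ WReach G le r v :=
  ⟨refl_of le v, .nil, by simp, by simp, by simp⟩

/-- A nonempty list has a least element for any linear order relation. -/
theorem List.exists_forall_rel {α : Type*} (le : α → α → Prop) [IsLinearOrder α le]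
    {l : List α} (hl : l ≠ []) : ∃ x ∈ l, ∀ y ∈ l, le x y := by
  induction l with
  | nil => exact absurd rfl hl
  | cons a l ih =>
    rcases eq_or_ne l [] with rfl | hl'
    · exact ⟨a, by simp, by simpa using refl_of le a⟩
    obtain ⟨x, hx, hmin⟩ := ih hl'
    rcases total_of le a x with h | h
    · refine ⟨a, by simp, fun y hy => ?_⟩
      rcases List.mem_cons.mp hy with rfl | hy
      · exact refl_of le y
      · exact trans_of le h (hmin y hy)
    · refine ⟨x, List.mem_cons_of_mem a hx, fun y hy => ?_⟩
      rcases List.mem_cons.mp hy with rfl | hy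
      · exact h
      · exact hmin y hy

/-- A path of length at most `r` has a vertex weakly `r`-reachable from both of its ends. -/
theorem exists_mem_support_mem_wreach {G : SimpleGraph V} (le : V → V → Prop)
    [IsLinearOrder V le] {r : ℕ} {u v : V} (p : G.Walk u v) (hp : p.length ≤ r) :
    ∃ x ∈ p.support, x ∈ WReach G le r u ∧ x ∈ WReach G le r v := by
  classical
  wlog hpath : p.IsPath generalizing p
  · obtain ⟨x, hx, h⟩ := this p.bypass (p.length_bypass_le_length.trans hp) p.bypass_isPath
    exact ⟨x, p.support_bypass_subset_support hx, h⟩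
  obtain ⟨x, hx, hmin⟩ := List.exists_forall_rel le p.support_ne_nil
  refine ⟨x, hx, ⟨hmin _ p.start_mem_support, (p.takeUntil x hx).reverse,
    (hpath.takeUntil hx).reverse, ?_, fun y hy hyx _ => ⟨hmin y ?_, hyx.symm⟩⟩,
    ⟨hmin _ p.end_mem_support, p.dropUntil x hx,
    hpath.dropUntil hx, ?_, fun y hy hyx _ => ⟨hmin y ?_, hyx.symm⟩⟩⟩
  · rw [Walk.length_reverse]
    exact (p.length_takeUntil_le_length hx).trans hp
  · exact p.support_takeUntil_subset_support hx (by simpa using hy)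
  · exact (p.length_dropUntil_le_length hx).trans hp
  · exact p.support_dropUntil_subset_support hx hy

/-- If `wcol_r(G) = c` and `|A| ≥ 4(2cm)^c`, then there are `S` with
`|S| ≤ c` and `B ⊆ A \ S` with `|B| ≥ m` that is distance-`r` independent in `G - S`. -/
theorem stmt12 {V : Type} [Fintype V] (G : SimpleGraph V) (A : Set V)
    (r m c : ℕ) (hc : wcol G r = c)
    (hA : 4 * (2 * c * m) ^ c ≤ A.ncard) :
    ∃ S : Set V, ∃ B : Set V, B ⊆ A \ S ∧ S.ncard ≤ c ∧ m ≤ B.ncard ∧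
      DistIndepIn G S r B := by
  classical
  obtain ⟨le, hle, hcard⟩ := exists_linearOrder_wcol G r
  have hfin : ∀ s : Set V, s.toFinset.card = s.ncard := fun s =>
    (Set.ncard_eq_toFinset_card' s).symm
  obtain ⟨S, B, hS, hBA, hdis, hmB, hinter⟩ := exists_sunflower c m c le_rfl A.toFinset
    (fun a => (WReach G le r a).toFinset) (fun a _ => by simpa using mem_wreach_self G le r a)
    (fun a _ => by rw [hfin, ← hc]; exact hcard a) (by rw [hfin]; omega)
  refine ⟨S, B, fun b hb => ⟨by simpa using hBA hb, Finset.disjoint_left.mp hdis hb⟩,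
    by simpa using hS, by simpa using hmB, fun u hu v hv huv p hpS => ?_⟩
  by_contra! hp
  obtain ⟨x, hx, hxu, hxv⟩ := exists_mem_support_mem_wreach le p hp
  exact hpS x hx (hinter u hu v hv huv (by simp [hxu, hxv]))
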